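/- arXiv:2309.15297 — 7 statements merged into one kernel-verified Lean document; each statement's English description precedes it below -/
import Mathlib

section
/- Let (𝒳, μ) be a probability space, γ ∈ (0, 1/2) and C > 0. Let v₀, v₁ : 𝒳 → ℝ be measurable with 0 ≤ v_z(x) ≤ C for z ∈ {0,1} and all x, let w : 𝒳 → ℝ be measurable, nonnegative and μ-integrable, and assume ∫ (v₀ + v₁ + w) dμ > 0. Let T ≥ 1, let κ₁, …, κ_T ∈ (0,1) with κ₁ + ⋯ + κ_T = 1, and let e₁, …, e_T : 𝒳 → [γ, 1−γ] be measurable. Define e₀ = Σ_{t=1}^T κ_t e_t, and for any measurable e : 𝒳 → [γ, 1−γ] define V(e) = ∫ ( v₁(x)/e(x) + v₀(x)/(1−e(x)) + w(x) ) dμ(x). Then V(e_t) > 0 for every t, V(e₀) > 0, and V(e₀) ≤ ( Σ_{t=1}^T κ_t V(e_t)^{-1} )^{-1}; equivalently, V(e₀)^{-1} ≥ Σ_{t=1}^T κ_t V(e_t)^{-1}. -/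
open MeasureTheory

section

variable {𝒳 : Type*} [MeasurableSpace 𝒳] {μ : Measure 𝒳} {γ C : ℝ} {v0 v1 w f : 𝒳 → ℝ}

theorem integrable_aipw_integrand [IsFiniteMeasure μ] (hγ0 : 0 < γ)
    (hv0m : Measurable v0) (hv1m : Measurable v1)
    (hv0 : ∀ x, 0 ≤ v0 x ∧ v0 x ≤ C) (hv1 : ∀ x, 0 ≤ v1 x ∧ v1 x ≤ C)
    (hwint : Integrable w μ) (hfm : Measurable f) (hf : ∀ x, γ ≤ f x ∧ f x ≤ 1 - γ) :
    Integrable (fun x => v1 x / f x + v0 x / (1 - f x) + w x) μ := by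
  have bounded_div : ∀ {v g : 𝒳 → ℝ}, Measurable v → Measurable g →
      (∀ x, 0 ≤ v x ∧ v x ≤ C) → (∀ x, γ ≤ g x) → Integrable (fun x => v x / g x) μ := by
    intro v g hvm hgm hv hg
    refine Integrable.of_bound (hvm.div hgm).aestronglyMeasurable (C / γ) (ae_of_all _ fun x => ?_)
    rw [Real.norm_of_nonneg (div_nonneg (hv x).1 (hγ0.le.trans (hg x)))]
    exact div_le_div₀ ((hv x).1.trans (hv x).2) (hv x).2 hγ0 (hg x)
  exact ((bounded_div hv1m hfm hv1 fun x => (hf x).1).add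
    (bounded_div hv0m (measurable_const.sub hfm) hv0 fun x => le_sub_comm.1 (hf x).2)).add hwint

theorem aipw_variance_pos [IsFiniteMeasure μ] (hγ0 : 0 < γ)
    (hv0m : Measurable v0) (hv1m : Measurable v1)
    (hv0 : ∀ x, 0 ≤ v0 x ∧ v0 x ≤ C) (hv1 : ∀ x, 0 ≤ v1 x ∧ v1 x ≤ C)
    (hwint : Integrable w μ) (hpos : 0 < ∫ x, (v0 x + v1 x + w x) ∂μ)
    (hfm : Measurable f) (hf : ∀ x, γ ≤ f x ∧ f x ≤ 1 - γ) :
    0 < ∫ x, (v1 x / f x + v0 x / (1 - f x) + w x) ∂μ := by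
  refine hpos.trans_le (integral_mono (.of_integral_ne_zero hpos.ne')
    (integrable_aipw_integrand hγ0 hv0m hv1m hv0 hv1 hwint hfm hf) fun x => ?_)
  obtain ⟨h1, h2⟩ := hf x
  have hv1_le : v1 x ≤ v1 x / f x :=
    le_div_self (hv1 x).1 (by linarith) (by linarith)
  have hv0_le : v0 x ≤ v0 x / (1 - f x) :=
    le_div_self (hv0 x).1 (by linarith) (by linarith)
  dsimp only
  linarith

end

/-- If `∑ c = 1`, then `a / ∑ κ g ≤ ∑ (c² / κ) (a / g)`. -/
theorem div_sum_mul_le_sum_sq_div_mul_div {ι : Type*} (s : Finset ι) {κ c g : ι → ℝ} {a : ℝ}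
    (hκ : ∀ t ∈ s, 0 < κ t) (hc : ∑ t ∈ s, c t = 1) (hg : ∀ t ∈ s, 0 < g t) (ha : 0 ≤ a) :
    a / ∑ t ∈ s, κ t * g t ≤ ∑ t ∈ s, c t ^ 2 / κ t * (a / g t) := by
  have h := Finset.sq_sum_div_le_sum_sq_div s c fun t ht => mul_pos (hκ t ht) (hg t ht)
  rw [hc, one_pow] at h
  calc a / ∑ t ∈ s, κ t * g t = a * (1 / ∑ t ∈ s, κ t * g t) := by ring
    _ ≤ a * ∑ t ∈ s, c t ^ 2 / (κ t * g t) := mul_le_mul_of_nonneg_left h ha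
    _ = ∑ t ∈ s, c t ^ 2 / κ t * (a / g t) := by
      rw [Finset.mul_sum]
      exact Finset.sum_congr rfl fun t _ => by rw [div_mul_div_comm, mul_comm a, div_mul_eq_mul_div]

/-- Pooling dominates linear aggregation (scalar / AIPW-ATE case).
`V(e)` is the asymptotic variance under propensity `e`, `e₀` is the mixture
propensity; then all the variances are positive and the pooled variance is
at most the inverse-variance-weighted aggregated variance. -/
theorem pooled_variance_le_aggregated_variance
    {𝒳 : Type*} [MeasurableSpace 𝒳] (μ : Measure 𝒳) [IsProbabilityMeasure μ]
    (γ C : ℝ) (hγ0 : 0 < γ) (hγ : γ < 1 / 2) (hC : 0 < C)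
    (v0 v1 w : 𝒳 → ℝ)
    (hv0m : Measurable v0) (hv1m : Measurable v1) (hwm : Measurable w)
    (hv0 : ∀ x, 0 ≤ v0 x ∧ v0 x ≤ C) (hv1 : ∀ x, 0 ≤ v1 x ∧ v1 x ≤ C)
    (hw0 : ∀ x, 0 ≤ w x) (hwint : Integrable w μ)
    (hpos : 0 < ∫ x, (v0 x + v1 x + w x) ∂μ)
    (T : ℕ) (hT : 1 ≤ T)
    (κ : Fin T → ℝ) (hκ : ∀ t, 0 < κ t ∧ κ t < 1) (hκsum : ∑ t, κ t = 1)
    (e : Fin T → 𝒳 → ℝ) (hem : ∀ t, Measurable (e t))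
    (he : ∀ t x, γ ≤ e t x ∧ e t x ≤ 1 - γ)
    (e0 : 𝒳 → ℝ) (he0 : ∀ x, e0 x = ∑ t, κ t * e t x)
    (V : (𝒳 → ℝ) → ℝ)
    (hV : ∀ f : 𝒳 → ℝ, V f = ∫ x, (v1 x / f x + v0 x / (1 - f x) + w x) ∂μ) :
    (∀ t, 0 < V (e t)) ∧ 0 < V e0 ∧
      V e0 ≤ (∑ t, κ t * (V (e t))⁻¹)⁻¹ ∧
      ∑ t, κ t * (V (e t))⁻¹ ≤ (V e0)⁻¹ := by
  have he0m : Measurable e0 := by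
    rw [funext he0]
    exact Finset.measurable_sum _ fun t _ => (hem t).const_mul _
  have he0' : ∀ x, 1 - e0 x = ∑ t, κ t * (1 - e t x) := fun x => by
    simp only [mul_sub, mul_one, Finset.sum_sub_distrib, hκsum, he0]
  have le_mix : ∀ g : Fin T → ℝ, (∀ t, γ ≤ g t) → γ ≤ ∑ t, κ t * g t := fun g hg => calc
    γ = ∑ t, κ t * γ := by rw [← Finset.sum_mul, hκsum, one_mul]
    _ ≤ ∑ t, κ t * g t :=
      Finset.sum_le_sum fun t _ => mul_le_mul_of_nonneg_left (hg t) (hκ t).1.le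
  have he0b : ∀ x, γ ≤ e0 x ∧ e0 x ≤ 1 - γ := fun x =>
    ⟨he0 x ▸ le_mix _ fun t => (he t x).1,
      le_sub_comm.1 (he0' x ▸ le_mix _ fun t => le_sub_comm.1 (he t x).2)⟩
  have hVpos : ∀ t, 0 < V (e t) := fun t => hV (e t) ▸
    aipw_variance_pos hγ0 hv0m hv1m hv0 hv1 hwint hpos (hem t) (he t)
  have hV0pos : 0 < V e0 := hV e0 ▸
    aipw_variance_pos hγ0 hv0m hv1m hv0 hv1 hwint hpos he0m he0b
  set S := ∑ t, κ t * (V (e t))⁻¹ with hS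
  have hSpos : 0 < S := Finset.sum_pos (fun t _ => mul_pos (hκ t).1 (inv_pos.2 (hVpos t)))
    ⟨⟨0, hT⟩, Finset.mem_univ _⟩
  let c : Fin T → ℝ := fun t => κ t * (V (e t))⁻¹ / S
  have hc : ∑ t, c t = 1 := by
    rw [← Finset.sum_div, ← hS, div_self hSpos.ne']
  have hint : ∀ t, Integrable (fun x => v1 x / e t x + v0 x / (1 - e t x) + w x) μ := fun t =>
    integrable_aipw_integrand hγ0 hv0m hv1m hv0 hv1 hwint (hem t) (he t)
  have hpt : ∀ x, v1 x / e0 x + v0 x / (1 - e0 x) + w x ≤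
      ∑ t, c t ^ 2 / κ t * (v1 x / e t x + v0 x / (1 - e t x) + w x) := fun x => by
    have hκpos : ∀ t ∈ Finset.univ, 0 < κ t := fun t _ => (hκ t).1
    have h1 := div_sum_mul_le_sum_sq_div_mul_div Finset.univ (g := fun t => e t x) hκpos hc
      (fun t _ => hγ0.trans_le (he t x).1) (hv1 x).1
    have h0 := div_sum_mul_le_sum_sq_div_mul_div Finset.univ (g := fun t => 1 - e t x) hκpos hc
      (fun t _ => by linarith [(he t x).2]) (hv0 x).1
    have hw := div_sum_mul_le_sum_sq_div_mul_div Finset.univ (g := fun _ => 1) hκpos hc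
      (fun _ _ => one_pos) (hw0 x)
    simp only [mul_one, hκsum, div_one] at hw
    rw [he0', he0]
    simp only [mul_add, Finset.sum_add_distrib]
    exact add_le_add (add_le_add h1 h0) hw
  have hmain : V e0 ≤ S⁻¹ := calc
    V e0 ≤ ∫ x, ∑ t, c t ^ 2 / κ t * (v1 x / e t x + v0 x / (1 - e t x) + w x) ∂μ := by
      rw [hV]
      exact integral_mono (integrable_aipw_integrand hγ0 hv0m hv1m hv0 hv1 hwint he0m he0b)
        (integrable_finsetSum _ fun t _ => (hint t).const_mul _) hpt
    _ = ∑ t, c t ^ 2 / κ t * V (e t) := by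
      rw [integral_finsetSum _ fun t _ => (hint t).const_mul _]
      simp only [integral_const_mul, hV]
    _ = ∑ t, c t / S := Finset.sum_congr rfl fun t _ => by
      have := (hκ t).1.ne'
      have := (hVpos t).ne'
      simp only [c]
      field_simp
    _ = S⁻¹ := by rw [← Finset.sum_div, hc, one_div]
  exact ⟨hVpos, hV0pos, hmain, (le_inv_comm₀ hV0pos hSpos).1 hmain⟩
end

section
/- Let (𝒳, μ) be a probability space, 0 < c ≤ C < ∞, and let v₀, v₁ : 𝒳 → [c, C] and ψ : 𝒳 → ℝ^p be measurable with ‖ψ(x)‖ ≤ C for all x. For a measurable e : 𝒳 → [0,1] define the p×p real symmetric matrix M(e) = ∫ [ e(x)(1−e(x)) / (v₀(x)e(x) + v₁(x)(1−e(x))) ] ψ(x)ψ(x)ᵀ dμ(x). Let T ≥ 1, let κ₁, …, κ_T ∈ (0,1) with κ₁ + ⋯ + κ_T = 1, let e₁, …, e_T : 𝒳 → [0,1] be measurable, and set e₀ = Σ_{t=1}^T κ_t e_t. If Σ_{t=1}^T κ_t M(e_t) is positive definite, then M(e₀) is positive definite, Σ_{t=1}^T κ_t M(e_t) ⪯ M(e₀),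 and M(e₀)⁻¹ ⪯ (Σ_{t=1}^T κ_t M(e_t))⁻¹ in the Loewner order. -/
open MeasureTheory

/-- Inversion is antitone on positive definite matrices for the Loewner order. -/
theorem Matrix.PosDef.posSemidef_inv_sub_inv {n : Type*} [Fintype n] [DecidableEq n]
    {A B : Matrix n n ℝ} (hA : A.PosDef) (hB : B.PosDef) (h : (B - A).PosSemidef) :
    (A⁻¹ - B⁻¹).PosSemidef := by
  have := hA.isUnit.invertible
  have := hB.isUnit.invertible
  have := hA.inv.isUnit.invertible
  have h₁ := Matrix.PosDef.fromBlocks₁₁ (1 : Matrix n n ℝ) A⁻¹ hB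
  have h₂ := Matrix.PosDef.fromBlocks₂₂ B (1 : Matrix n n ℝ) hA.inv
  simp only [Matrix.conjTranspose_one, one_mul, mul_one, Matrix.inv_inv_of_invertible] at h₁ h₂
  exact h₁.1 (h₂.2 h)

/-- A nonnegatively weighted second moment matrix is positive semidefinite. -/
theorem Matrix.posSemidef_integral_mul {X ι : Type*} [MeasurableSpace X] [Fintype ι]
    {μ : Measure X} {w : X → ℝ} {f : X → ι → ℝ} (hw : ∀ x, 0 ≤ w x)
    (hint : ∀ i j, Integrable (fun x => w x * (f x i * f x j)) μ) :
    (Matrix.of fun i j => ∫ x, w x * (f x i * f x j) ∂μ).PosSemidef := by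
  refine .of_dotProduct_mulVec_nonneg ?_ fun y => ?_
  · ext i j
    simp [mul_comm (f _ i)]
  · have key : dotProduct (star y)
        ((Matrix.of fun i j => ∫ x, w x * (f x i * f x j) ∂μ).mulVec y) =
        ∫ x, w x * (∑ i, y i * f x i) ^ 2 ∂μ := by
      calc
        _ = ∑ i, ∑ j, ∫ x, y i * y j * (w x * (f x i * f x j)) ∂μ := by
          simp only [dotProduct, Matrix.mulVec, Matrix.of_apply, star_trivial, Finset.mul_sum,
            integral_const_mul]
          exact Finset.sum_congr rfl fun i _ => Finset.sum_congr rfl fun j _ => by ring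
        _ = ∫ x, ∑ i, ∑ j, y i * y j * (w x * (f x i * f x j)) ∂μ := by
          rw [integral_finsetSum _ fun i _ =>
            integrable_finsetSum _ fun j _ => (hint i j).const_mul _]
          exact Finset.sum_congr rfl fun i _ =>
            (integral_finsetSum _ fun j _ => (hint i j).const_mul _).symm
        _ = _ := by
          refine integral_congr_ae (.of_forall fun x => ?_)
          simp only [sq, Finset.sum_mul_sum]
          simp only [Finset.mul_sum]
          exact Finset.sum_congr rfl fun i _ => Finset.sum_congr rfl fun j _ => by ring
    rw [key]
    exact integral_nonneg fun x => mul_nonneg (hw x) (sq_nonneg _)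

theorem mix_pos {a b u : ℝ} (ha : 0 < a) (hb : 0 < b) (hu : u ∈ Set.Icc (0 : ℝ) 1) :
    0 < a * u + b * (1 - u) := by
  simpa [mul_comm] using
    convex_Ioi (0 : ℝ) ha hb hu.1 (sub_nonneg.2 hu.2) (add_sub_cancel _ _)

/-- The efficient weight lies below its tangent line at any point `v`. -/
theorem weight_le_tangent {a b u v : ℝ} (ha : 0 < a) (hb : 0 < b)
    (hu : u ∈ Set.Icc (0 : ℝ) 1) (hv : v ∈ Set.Icc (0 : ℝ) 1) :
    u * (1 - u) / (a * u + b * (1 - u)) ≤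
      (b * (1 - v) ^ 2 * u + a * v ^ 2 * (1 - u)) / (a * v + b * (1 - v)) ^ 2 := by
  rw [div_le_div_iff₀ (mix_pos ha hb hu) (pow_pos (mix_pos ha hb hv) 2)]
  have := mul_nonneg (mul_pos ha hb).le (sq_nonneg (u - v))
  linear_combination this

/-- Jensen's inequality for the efficient weight. -/
theorem sum_weight_le {ι : Type*} [Fintype ι] {a b v : ℝ} {κ u : ι → ℝ}
    (ha : 0 < a) (hb : 0 < b) (hκ : ∀ t, 0 ≤ κ t) (hκsum : ∑ t, κ t = 1)
    (hu : ∀ t, u t ∈ Set.Icc (0 : ℝ) 1) (hv : v ∈ Set.Icc (0 : ℝ) 1)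
    (huv : v = ∑ t, κ t * u t) :
    ∑ t, κ t * (u t * (1 - u t) / (a * u t + b * (1 - u t))) ≤
      v * (1 - v) / (a * v + b * (1 - v)) := by
  have hD := (mix_pos ha hb hv).ne'
  set D := a * v + b * (1 - v) with hDdef
  calc
    _ ≤ ∑ t, κ t * ((b * (1 - v) ^ 2 * u t + a * v ^ 2 * (1 - u t)) / D ^ 2) :=
      Finset.sum_le_sum fun t _ =>
        mul_le_mul_of_nonneg_left (weight_le_tangent ha hb (hu t) hv) (hκ t)
    _ = ∑ t, (b * (1 - v) ^ 2 / D ^ 2 * (κ t * u t) +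
          a * v ^ 2 / D ^ 2 * (κ t - κ t * u t)) :=
      Finset.sum_congr rfl fun t _ => by ring
    _ = b * (1 - v) ^ 2 / D ^ 2 * v + a * v ^ 2 / D ^ 2 * (1 - v) := by
      rw [Finset.sum_add_distrib, ← Finset.mul_sum, ← Finset.mul_sum, Finset.sum_sub_distrib,
        hκsum, ← huv]
    _ = v * (1 - v) / D := by
      field_simp
      rw [hDdef]
      ring

theorem weight_mem_Icc {a b c u : ℝ} (hc : 0 < c) (ha : c ≤ a) (hb : c ≤ b)
    (hu : u ∈ Set.Icc (0 : ℝ) 1) :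
    u * (1 - u) / (a * u + b * (1 - u)) ∈ Set.Icc 0 (1 / c) := by
  obtain ⟨h0, h1⟩ := hu
  refine ⟨div_nonneg (mul_nonneg h0 (sub_nonneg.2 h1))
    (mix_pos (hc.trans_le ha) (hc.trans_le hb) ⟨h0, h1⟩).le, ?_⟩
  exact div_le_div₀ zero_le_one (by nlinarith) hc
    (by nlinarith [mul_nonneg (sub_nonneg.2 ha) h0,
      mul_nonneg (sub_nonneg.2 hb) (sub_nonneg.2 h1)])

/-- Pooling dominates linear aggregation for the partially linear
model.  `M e` is the information matrix of the efficient weighted least squares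
estimator under propensity `e`; `e₀` is the mixture propensity.  If the
aggregated information `∑ κ_t • M(e_t)` is positive definite, then so is
`M(e₀)`, `∑ κ_t • M(e_t) ⪯ M(e₀)` and `M(e₀)⁻¹ ⪯ (∑ κ_t • M(e_t))⁻¹` in the
Loewner order. -/
theorem pooled_info_dominates_aggregated_info
    {𝒳 : Type*} [MeasurableSpace 𝒳] (μ : Measure 𝒳) [IsProbabilityMeasure μ]
    (p : ℕ) (c C : ℝ) (hc : 0 < c) (hcC : c ≤ C)
    (v0 v1 : 𝒳 → ℝ) (hv0m : Measurable v0) (hv1m : Measurable v1)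
    (hv0 : ∀ x, v0 x ∈ Set.Icc c C) (hv1 : ∀ x, v1 x ∈ Set.Icc c C)
    (ψ : 𝒳 → EuclideanSpace ℝ (Fin p)) (hψm : Measurable ψ) (hψ : ∀ x, ‖ψ x‖ ≤ C)
    (M : (𝒳 → ℝ) → Matrix (Fin p) (Fin p) ℝ)
    (hM : ∀ e : 𝒳 → ℝ, M e = Matrix.of fun i j =>
      ∫ x, (e x * (1 - e x) / (v0 x * e x + v1 x * (1 - e x))) * (ψ x i * ψ x j) ∂μ)
    (T : ℕ) (hT : 1 ≤ T)
    (κ : Fin T → ℝ) (hκ : ∀ t, κ t ∈ Set.Ioo (0 : ℝ) 1) (hκsum : ∑ t, κ t = 1)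
    (e : Fin T → 𝒳 → ℝ) (hem : ∀ t, Measurable (e t))
    (he : ∀ t x, e t x ∈ Set.Icc (0 : ℝ) 1)
    (e0 : 𝒳 → ℝ) (he0 : ∀ x, e0 x = ∑ t, κ t * e t x)
    (hpos : (∑ t, κ t • M (e t)).PosDef) :
    (M e0).PosDef ∧ (M e0 - ∑ t, κ t • M (e t)).PosSemidef ∧
      ((∑ t, κ t • M (e t))⁻¹ - (M e0)⁻¹).PosSemidef := by
  have he0m : Measurable e0 := by
    rw [funext he0]
    fun_prop
  have he0I : ∀ x, e0 x ∈ Set.Icc (0 : ℝ) 1 := fun x => by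
    simpa [he0 x] using (convex_Icc (0 : ℝ) 1).sum_mem (t := Finset.univ)
      (fun t _ => (hκ t).1.le) hκsum fun t _ => he t x
  have hint : ∀ f : 𝒳 → ℝ, Measurable f → (∀ x, f x ∈ Set.Icc (0 : ℝ) 1) → ∀ i j,
      Integrable (fun x =>
        (f x * (1 - f x) / (v0 x * f x + v1 x * (1 - f x))) * (ψ x i * ψ x j)) μ := by
    intro f hf hfI i j
    refine .of_bound (by fun_prop) (1 / c * (C * C)) (.of_forall fun x => ?_)
    have hw := weight_mem_Icc hc (hv0 x).1 (hv1 x).1 (hfI x)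
    have hψi : ∀ i, ‖ψ x i‖ ≤ C := fun i => (PiLp.norm_apply_le (ψ x) i).trans (hψ x)
    rw [norm_mul, norm_mul, Real.norm_of_nonneg hw.1]
    exact mul_le_mul hw.2 (mul_le_mul (hψi i) (hψi j) (norm_nonneg _) (hc.le.trans hcC))
      (by positivity) (by positivity)
  have hdiff : M e0 - ∑ t, κ t • M (e t) = Matrix.of fun i j => ∫ x,
      (e0 x * (1 - e0 x) / (v0 x * e0 x + v1 x * (1 - e0 x)) -
        ∑ t, κ t * (e t x * (1 - e t x) / (v0 x * e t x + v1 x * (1 - e t x)))) *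
          (ψ x i * ψ x j) ∂μ := by
    ext i j
    simp only [hM, Matrix.sub_apply, Matrix.sum_apply, Matrix.smul_apply, Matrix.of_apply,
      smul_eq_mul, sub_mul, Finset.sum_mul, mul_assoc (κ _)]
    rw [integral_sub (hint e0 he0m he0I i j)
        (integrable_finsetSum _ fun t _ => (hint (e t) (hem t) (he t) i j).const_mul _),
      integral_finsetSum _ fun t _ => (hint (e t) (hem t) (he t) i j).const_mul _]
    simp only [integral_const_mul]
  have hle : (M e0 - ∑ t, κ t • M (e t)).PosSemidef := by
    rw [hdiff]
    refine Matrix.posSemidef_integral_mul (f := fun x i => ψ x i) (fun x => sub_nonneg.2 ?_)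
      fun i j => ?_
    · exact sum_weight_le (hc.trans_le (hv0 x).1) (hc.trans_le (hv1 x).1) (fun t => (hκ t).1.le)
        hκsum (fun t => he t x) (he0I x) (he0 x)
    · simp only [sub_mul, Finset.sum_mul, mul_assoc (κ _)]
      exact (hint e0 he0m he0I i j).sub
        (integrable_finsetSum _ fun t _ => (hint (e t) (hem t) (he t) i j).const_mul _)
  have hpd : (M e0).PosDef := by
    simpa using hpos.add_posSemidef hle
  exact ⟨hpd, hle, hpos.posSemidef_inv_sub_inv hpd hle⟩
end

section
/- For all real numbers v₀ > 0 and v₁ > 0, the function e ↦ e(1−e) / (v₀ e + v₁(1−e)) is concave on the interval [0,1]. -/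
/-- For positive variances `v₀, v₁`, the map
`e ↦ e(1−e) / (v₀ e + v₁ (1−e))` is concave on `[0,1]`. -/
theorem concaveOn_propensity_variance_ratio (v0 v1 : ℝ) (hv0 : 0 < v0) (hv1 : 0 < v1) :
    ConcaveOn ℝ (Set.Icc (0 : ℝ) 1)
      (fun e : ℝ => e * (1 - e) / (v0 * e + v1 * (1 - e))) := by
  have hpos : ∀ e ∈ Set.Icc (0 : ℝ) 1, 0 < v0 * e + v1 * (1 - e) := by
    rintro e ⟨h0, h1⟩
    rcases h0.eq_or_lt with rfl | h0
    · simpa using hv1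
    · have := mul_pos hv0 h0
      have := mul_nonneg hv1.le (sub_nonneg.2 h1)
      linarith
  refine ⟨convex_Icc 0 1, fun x hx y hy s t hs ht hst => ?_⟩
  have hDx := hpos x hx
  have hDy := hpos y hy
  have hDz := hpos _ (convex_Icc (0 : ℝ) 1 hx hy hs ht hst)
  simp only [smul_eq_mul] at hDz ⊢
  obtain rfl : t = 1 - s := by linarith
  have key : (s * x + (1 - s) * y) * (1 - (s * x + (1 - s) * y)) /
        (v0 * (s * x + (1 - s) * y) + v1 * (1 - (s * x + (1 - s) * y))) -
      (s * (x * (1 - x) / (v0 * x + v1 * (1 - x))) +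
        (1 - s) * (y * (1 - y) / (v0 * y + v1 * (1 - y)))) =
      v0 * v1 * (s * (1 - s)) * (x - y) ^ 2 /
        ((v0 * (s * x + (1 - s) * y) + v1 * (1 - (s * x + (1 - s) * y))) *
          (v0 * x + v1 * (1 - x)) * (v0 * y + v1 * (1 - y))) := by
    rw [← mul_div_assoc, ← mul_div_assoc, div_add_div _ _ hDx.ne' hDy.ne',
      div_sub_div _ _ hDz.ne' (by positivity), div_eq_div_iff (by positivity) (by positivity)]
    ring
  rw [← sub_nonneg, key]
  positivity
end

section
/- Let (𝒳, P) be a probability space, let ℰ be a set of measurable functions 𝒳 → [0,1], and let ε > 0. Suppose S ⊆ ℰ is such that for every f ∈ ℰ there exists s ∈ S with (∫ (f − s)² dP)^{1/2} ≤ ε/4. Then for all f, g ∈ ℰ there exist s, t ∈ S such that (∫ ( (f − g)² − (s − t)² )² dP)^{1/2} ≤ ε. -/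
open MeasureTheory

theorem sq_sub_sq_sub_sq_le {a b c d : ℝ} (ha : a ∈ Set.Icc (0 : ℝ) 1)
    (hb : b ∈ Set.Icc (0 : ℝ) 1) (hc : c ∈ Set.Icc (0 : ℝ) 1) (hd : d ∈ Set.Icc (0 : ℝ) 1) :
    ((a - b) ^ 2 - (c - d) ^ 2) ^ 2 ≤ 8 * (a - c) ^ 2 + 8 * (b - d) ^ 2 := by
  obtain ⟨ha0, ha1⟩ := ha
  obtain ⟨hb0, hb1⟩ := hb
  obtain ⟨hc0, hc1⟩ := hc
  obtain ⟨hd0, hd1⟩ := hd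
  have hsum : (a - b + (c - d)) ^ 2 ≤ 2 ^ 2 :=
    sq_le_sq' (by linarith) (by linarith)
  calc ((a - b) ^ 2 - (c - d) ^ 2) ^ 2
      = (a - b + (c - d)) ^ 2 * ((a - c) - (b - d)) ^ 2 := by ring
    _ ≤ 2 ^ 2 * ((a - c) - (b - d)) ^ 2 := by gcongr
    _ ≤ 8 * (a - c) ^ 2 + 8 * (b - d) ^ 2 := by
      linarith [sq_nonneg ((a - c) + (b - d))]

theorem integrable_sub_sq_of_mem_Icc {𝒳 : Type*} [MeasurableSpace 𝒳] {P : Measure 𝒳}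
    [IsFiniteMeasure P] {f g : 𝒳 → ℝ} (hf : Measurable f) (hg : Measurable g)
    (hf01 : ∀ x, f x ∈ Set.Icc (0 : ℝ) 1) (hg01 : ∀ x, g x ∈ Set.Icc (0 : ℝ) 1) :
    Integrable (fun x ↦ (f x - g x) ^ 2) P := by
  refine Integrable.of_bound ((hf.sub hg).pow_const 2).aestronglyMeasurable 1 (.of_forall fun x ↦ ?_)
  rw [Real.norm_of_nonneg (sq_nonneg _), sq_le_one_iff_abs_le_one, abs_le]
  constructor <;> linarith [(hf01 x).1, (hf01 x).2, (hg01 x).1, (hg01 x).2]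

/-- An `ε/4`-net of a class `ℰ` of `[0,1]`-valued functions in
`L²(P)` yields an `ε`-net of the class of squared differences
`{(f − g)² : f, g ∈ ℰ}`. -/
theorem squared_difference_net
    {𝒳 : Type*} [MeasurableSpace 𝒳] (P : Measure 𝒳) [IsProbabilityMeasure P]
    (ℰ : Set (𝒳 → ℝ))
    (hℰ : ∀ e ∈ ℰ, Measurable e ∧ ∀ x, e x ∈ Set.Icc (0 : ℝ) 1)
    (ε : ℝ) (hε : 0 < ε) (S : Set (𝒳 → ℝ)) (hS : S ⊆ ℰ)
    (hcover : ∀ f ∈ ℰ, ∃ s ∈ S, Real.sqrt (∫ x, (f x - s x) ^ 2 ∂P) ≤ ε / 4) :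
    ∀ f ∈ ℰ, ∀ g ∈ ℰ, ∃ s ∈ S, ∃ t ∈ S,
      Real.sqrt (∫ x, ((f x - g x) ^ 2 - (s x - t x) ^ 2) ^ 2 ∂P) ≤ ε := by
  intro f hf g hg
  obtain ⟨s, hs, hfs⟩ := hcover f hf
  obtain ⟨t, ht, hgt⟩ := hcover g hg
  refine ⟨s, hs, t, ht, ?_⟩
  obtain ⟨hfm, hf01⟩ := hℰ f hf
  obtain ⟨hgm, hg01⟩ := hℰ g hg
  obtain ⟨hsm, hs01⟩ := hℰ s (hS hs)
  obtain ⟨htm, ht01⟩ := hℰ t (hS ht)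
  have hfsi := (integrable_sub_sq_of_mem_Icc (P := P) hfm hsm hf01 hs01).const_mul 8
  have hgti := (integrable_sub_sq_of_mem_Icc (P := P) hgm htm hg01 ht01).const_mul 8
  rw [Real.sqrt_le_left (by positivity)] at hfs hgt ⊢
  calc ∫ x, ((f x - g x) ^ 2 - (s x - t x) ^ 2) ^ 2 ∂P
      ≤ ∫ x, (8 * (f x - s x) ^ 2 + 8 * (g x - t x) ^ 2) ∂P :=
        integral_mono_of_nonneg (.of_forall fun x ↦ sq_nonneg _) (hfsi.add hgti)
          (.of_forall fun x ↦ sq_sub_sq_sub_sq_le (hf01 x) (hg01 x) (hs01 x) (ht01 x))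
    _ = 8 * ∫ x, (f x - s x) ^ 2 ∂P + 8 * ∫ x, (g x - t x) ^ 2 ∂P := by
        rw [integral_add hfsi hgti, integral_const_mul, integral_const_mul]
    _ ≤ ε ^ 2 := by linarith
end

section
/- Let p ≥ 1, let 0 < k < K, and let A and B be real symmetric p×p matrices with kI ⪯ A ⪯ KI and kI ⪯ B ⪯ KI. Then ‖A⁻² − B⁻²‖_F ≤ 2K k⁻⁴ ‖A − B‖_F. -/
/-- The Frobenius norm of a real matrix: the square root of the sum of the
squares of its entries. -/
noncomputable def frobNorm {p : ℕ} (M : Matrix (Fin p) (Fin p) ℝ) : ℝ :=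
  Real.sqrt (∑ i, ∑ j, (M i j) ^ 2)

open Matrix

lemma frobNorm_nonneg {p : ℕ} (M : Matrix (Fin p) (Fin p) ℝ) : 0 ≤ frobNorm M :=
  Real.sqrt_nonneg _

lemma frobNorm_add_le {p : ℕ} (M N : Matrix (Fin p) (Fin p) ℝ) :
    frobNorm (M + N) ≤ frobNorm M + frobNorm N := by
  let := Matrix.frobeniusNormedAddCommGroup (m := Fin p) (n := Fin p) (α := ℝ)
  have h (X : Matrix (Fin p) (Fin p) ℝ) : frobNorm X = ‖X‖ := by
    rw [frobNorm, Matrix.frobenius_norm_def, Real.sqrt_eq_rpow]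
    simp
  simpa only [h] using norm_add_le M N

lemma frobNorm_transpose {p : ℕ} (M : Matrix (Fin p) (Fin p) ℝ) : frobNorm Mᵀ = frobNorm M := by
  rw [frobNorm, Finset.sum_comm]
  rfl

lemma frobNorm_sub_comm {p : ℕ} (M N : Matrix (Fin p) (Fin p) ℝ) :
    frobNorm (M - N) = frobNorm (N - M) := by
  simp only [frobNorm, Matrix.sub_apply, sub_sq_comm]

lemma sq_mul_dotProduct_le_mulVec {p : ℕ} {k : ℝ} (hk : 0 ≤ k) {A : Matrix (Fin p) (Fin p) ℝ}
    (hA : (A - k • (1 : Matrix (Fin p) (Fin p) ℝ)).PosSemidef) (v : Fin p → ℝ) :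
    k ^ 2 * (v ⬝ᵥ v) ≤ (A *ᵥ v) ⬝ᵥ (A *ᵥ v) := by
  have h₁ : 0 ≤ v ⬝ᵥ (A *ᵥ v) - k * (v ⬝ᵥ v) := by
    simpa [Matrix.sub_mulVec, Matrix.smul_mulVec] using hA.dotProduct_mulVec_nonneg v
  have h₂ : 0 ≤ (A *ᵥ v - k • v) ⬝ᵥ (A *ᵥ v - k • v) :=
    Finset.sum_nonneg fun i _ => mul_self_nonneg _
  simp only [sub_dotProduct, dotProduct_sub, smul_dotProduct, dotProduct_smul, smul_eq_mul,
    dotProduct_comm (A *ᵥ v) v] at h₂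
  nlinarith [mul_nonneg hk h₁]

lemma mul_frobNorm_le_frobNorm_mul {p : ℕ} {k : ℝ} (hk : 0 ≤ k) {A : Matrix (Fin p) (Fin p) ℝ}
    (hA : (A - k • (1 : Matrix (Fin p) (Fin p) ℝ)).PosSemidef) (M : Matrix (Fin p) (Fin p) ℝ) :
    k * frobNorm M ≤ frobNorm (A * M) := by
  rw [← frobNorm_transpose M, ← frobNorm_transpose (A * M), frobNorm]
  refine Real.le_sqrt_of_sq_le ?_
  rw [mul_pow, Real.sq_sqrt (by positivity), Finset.mul_sum]
  refine Finset.sum_le_sum fun j _ => ?_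
  simpa only [dotProduct, mulVec, Matrix.mul_apply, transpose_apply,
    ← sq] using sq_mul_dotProduct_le_mulVec hk hA (fun i => M i j)

lemma isUnit_det_of_loewner_lower_bound {p : ℕ} {k : ℝ} (hk : 0 < k)
    {A : Matrix (Fin p) (Fin p) ℝ}
    (hA : (A - k • (1 : Matrix (Fin p) (Fin p) ℝ)).PosSemidef) : IsUnit A.det := by
  have h : A.PosDef := by
    simpa using (Matrix.PosDef.one.smul hk).posSemidef_add hA
  exact h.det_pos.ne'.isUnit

lemma frobNorm_inv_mul_le {p : ℕ} {k : ℝ} (hk : 0 < k) {A : Matrix (Fin p) (Fin p) ℝ}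
    (hA : (A - k • (1 : Matrix (Fin p) (Fin p) ℝ)).PosSemidef) (M : Matrix (Fin p) (Fin p) ℝ) :
    frobNorm (A⁻¹ * M) ≤ k⁻¹ * frobNorm M := by
  have h := mul_frobNorm_le_frobNorm_mul hk.le hA (A⁻¹ * M)
  rw [Matrix.mul_nonsing_inv_cancel_left _ _ (isUnit_det_of_loewner_lower_bound hk hA)] at h
  exact (le_inv_mul_iff₀ hk).2 h

lemma frobNorm_mul_inv_le {p : ℕ} {k : ℝ} (hk : 0 < k) {A : Matrix (Fin p) (Fin p) ℝ}
    (hAs : A.IsSymm) (hA : (A - k • (1 : Matrix (Fin p) (Fin p) ℝ)).PosSemidef)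
    (M : Matrix (Fin p) (Fin p) ℝ) :
    frobNorm (M * A⁻¹) ≤ k⁻¹ * frobNorm M := by
  rw [← frobNorm_transpose, ← frobNorm_transpose M, Matrix.transpose_mul,
    Matrix.transpose_nonsing_inv, hAs.eq]
  exact frobNorm_inv_mul_le hk hA _

/-- If `kI ⪯ A ⪯ KI` and `kI ⪯ B ⪯ KI` with `0 < k < K`, then
`‖A⁻² − B⁻²‖_F ≤ 2K k⁻⁴ ‖A − B‖_F`. -/
theorem inverse_sq_lipschitz_of_loewner_bounds
    (p : ℕ) (hp : 1 ≤ p) (k K : ℝ) (hk : 0 < k) (hkK : k < K)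
    (A B : Matrix (Fin p) (Fin p) ℝ) (hAs : A.IsSymm) (hBs : B.IsSymm)
    (hAk : (A - k • (1 : Matrix (Fin p) (Fin p) ℝ)).PosSemidef)
    (hAK : (K • (1 : Matrix (Fin p) (Fin p) ℝ) - A).PosSemidef)
    (hBk : (B - k • (1 : Matrix (Fin p) (Fin p) ℝ)).PosSemidef)
    (hBK : (K • (1 : Matrix (Fin p) (Fin p) ℝ) - B).PosSemidef) :
    frobNorm (A⁻¹ * A⁻¹ - B⁻¹ * B⁻¹) ≤ 2 * K * k⁻¹ ^ 4 * frobNorm (A - B) := by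
  have hk' : 0 ≤ k⁻¹ := by positivity
  have hA := isUnit_det_of_loewner_lower_bound hk hAk
  have hB := isUnit_det_of_loewner_lower_bound hk hBk
  have hinv : A⁻¹ - B⁻¹ = A⁻¹ * ((B - A) * B⁻¹) := by
    rw [Matrix.sub_mul, Matrix.mul_sub, Matrix.mul_nonsing_inv _ hB,
      Matrix.nonsing_inv_mul_cancel_left _ _ hA, Matrix.mul_one]
  have hdiff : frobNorm (A⁻¹ - B⁻¹) ≤ k⁻¹ * (k⁻¹ * frobNorm (A - B)) := by
    rw [hinv, frobNorm_sub_comm A B]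
    exact (frobNorm_inv_mul_le hk hAk _).trans
      (mul_le_mul_of_nonneg_left (frobNorm_mul_inv_le hk hBs hBk _) hk')
  have hsplit : A⁻¹ * A⁻¹ - B⁻¹ * B⁻¹ = A⁻¹ * (A⁻¹ - B⁻¹) + (A⁻¹ - B⁻¹) * B⁻¹ := by
    noncomm_ring
  calc frobNorm (A⁻¹ * A⁻¹ - B⁻¹ * B⁻¹)
      ≤ k⁻¹ * frobNorm (A⁻¹ - B⁻¹) + k⁻¹ * frobNorm (A⁻¹ - B⁻¹) := by
        rw [hsplit]
        exact (frobNorm_add_le _ _).trans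
          (add_le_add (frobNorm_inv_mul_le hk hAk _) (frobNorm_mul_inv_le hk hBs hBk _))
    _ ≤ 2 * (k * k⁻¹ ^ 4) * frobNorm (A - B) := by
        have hcube : k * k⁻¹ ^ 4 = k⁻¹ ^ 3 := by field_simp
        rw [hcube]
        linarith [mul_le_mul_of_nonneg_left hdiff hk']
    _ ≤ 2 * K * k⁻¹ ^ 4 * frobNorm (A - B) := by
        rw [mul_assoc 2 K]
        have := frobNorm_nonneg (A - B)
        gcongr
end

section
/- Let p ≥ 1, K > 0, t ∈ ℝ, and let A be a real symmetric positive definite p×p matrix with A ⪯ KI and tr(A⁻¹) ≤ t. Then t > (p−1)/K and A ⪰ (t − (p−1)/K)⁻¹ I; in particular every eigenvalue of A is at least (t − (p−1)/K)⁻¹. -/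
namespace Matrix.IsHermitian

variable {n : Type*} [Fintype n] [DecidableEq n] {A : Matrix n n ℝ}

theorem eq_unitary_mul_diagonal_mul_star (hA : A.IsHermitian) :
    A = (hA.eigenvectorUnitary : Matrix n n ℝ) * diagonal hA.eigenvalues *
      star (hA.eigenvectorUnitary : Matrix n n ℝ) := by
  conv_lhs => rw [hA.spectral_theorem, Unitary.conjStarAlgAut_apply]
  rfl

theorem posSemidef_sub_smul_one_iff (hA : A.IsHermitian) (c : ℝ) :
    (A - c • (1 : Matrix n n ℝ)).PosSemidef ↔ ∀ i, c ≤ hA.eigenvalues i := by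
  have hU := Unitary.mul_star_self_of_mem hA.eigenvectorUnitary.2
  have h : A - c • (1 : Matrix n n ℝ) =
      (hA.eigenvectorUnitary : Matrix n n ℝ) * diagonal (fun i => hA.eigenvalues i - c) *
        star (hA.eigenvectorUnitary : Matrix n n ℝ) := by
    rw [← diagonal_sub, ← smul_one_eq_diagonal, mul_sub, sub_mul, mul_smul_comm, mul_one,
      smul_mul_assoc, hU, ← hA.eq_unitary_mul_diagonal_mul_star]
  rw [h, Matrix.IsUnit.posSemidef_star_right_conjugate_iff Unitary.isUnit_coe,
    posSemidef_diagonal_iff]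
  simp only [sub_nonneg]

theorem posSemidef_smul_one_sub_iff (hA : A.IsHermitian) (c : ℝ) :
    (c • (1 : Matrix n n ℝ) - A).PosSemidef ↔ ∀ i, hA.eigenvalues i ≤ c := by
  have hU := Unitary.mul_star_self_of_mem hA.eigenvectorUnitary.2
  have h : c • (1 : Matrix n n ℝ) - A =
      (hA.eigenvectorUnitary : Matrix n n ℝ) * diagonal (fun i => c - hA.eigenvalues i) *
        star (hA.eigenvectorUnitary : Matrix n n ℝ) := by
    rw [← diagonal_sub, ← smul_one_eq_diagonal, mul_sub, sub_mul, mul_smul_comm, mul_one,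
      smul_mul_assoc, hU, ← hA.eq_unitary_mul_diagonal_mul_star]
  rw [h, Matrix.IsUnit.posSemidef_star_right_conjugate_iff Unitary.isUnit_coe,
    posSemidef_diagonal_iff]
  simp only [sub_nonneg]

end Matrix.IsHermitian

theorem Matrix.PosDef.trace_inv_eq_sum_inv_eigenvalues {n : Type*} [Fintype n] [DecidableEq n]
    {A : Matrix n n ℝ} (hA : A.PosDef) : (A⁻¹).trace = ∑ i, (hA.1.eigenvalues i)⁻¹ := by
  have hU := Unitary.mul_star_self_of_mem hA.1.eigenvectorUnitary.2
  have hU' := Unitary.star_mul_self_of_mem hA.1.eigenvectorUnitary.2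
  have hD : diagonal hA.1.eigenvalues * diagonal (fun i => (hA.1.eigenvalues i)⁻¹) = 1 := by
    simp [diagonal_mul_diagonal, mul_inv_cancel₀ (hA.eigenvalues_pos _).ne']
  have h : A⁻¹ = (hA.1.eigenvectorUnitary : Matrix n n ℝ) *
      diagonal (fun i => (hA.1.eigenvalues i)⁻¹) *
        star (hA.1.eigenvectorUnitary : Matrix n n ℝ) := by
    refine inv_eq_right_inv ?_
    conv_lhs => enter [1]; rw [hA.1.eq_unitary_mul_diagonal_mul_star]
    rw [mul_assoc, mul_assoc, ← mul_assoc (star _), ← mul_assoc (star _), hU', one_mul,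
      ← mul_assoc (diagonal _), hD, one_mul, hU]
  rw [h, trace_mul_cycle, hU', one_mul, trace_diagonal]


/-- If `A` is positive definite with `A ⪯ KI` and
`tr(A⁻¹) ≤ t`, then `t > (p−1)/K` and `A ⪰ (t − (p−1)/K)⁻¹ I`; in particular
every eigenvalue of `A` is at least `(t − (p−1)/K)⁻¹`. -/
theorem eigenvalue_lower_bound_of_trace_inv
    (p : ℕ) (hp : 1 ≤ p) (K t : ℝ) (hK : 0 < K)
    (A : Matrix (Fin p) (Fin p) ℝ) (hA : A.PosDef)
    (hAK : (K • (1 : Matrix (Fin p) (Fin p) ℝ) - A).PosSemidef)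
    (htr : (A⁻¹).trace ≤ t) :
    ((p : ℝ) - 1) / K < t ∧
      (A - (t - ((p : ℝ) - 1) / K)⁻¹ • (1 : Matrix (Fin p) (Fin p) ℝ)).PosSemidef ∧
      (∀ i, (t - ((p : ℝ) - 1) / K)⁻¹ ≤ hA.1.eigenvalues i) := by
  have hpos := hA.eigenvalues_pos
  have hle := (hA.1.posSemidef_smul_one_sub_iff K).1 hAK
  have key (i : Fin p) : (hA.1.eigenvalues i)⁻¹ ≤ t - ((p : ℝ) - 1) / K := by
    have hcard : ((Finset.univ.erase i).card : ℝ) = (p : ℝ) - 1 := by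
      rw [Finset.card_erase_of_mem (Finset.mem_univ i), Finset.card_fin, Nat.cast_pred hp]
    have hsum := Finset.card_nsmul_le_sum (Finset.univ.erase i)
      (fun j => (hA.1.eigenvalues j)⁻¹) K⁻¹ fun j _ => inv_anti₀ (hpos j) (hle j)
    rw [nsmul_eq_mul, hcard, ← div_eq_mul_inv] at hsum
    rw [hA.trace_inv_eq_sum_inv_eigenvalues,
      ← Finset.add_sum_erase _ _ (Finset.mem_univ i)] at htr
    linarith
  have hbound (i : Fin p) : (t - ((p : ℝ) - 1) / K)⁻¹ ≤ hA.1.eigenvalues i :=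
    inv_le_of_inv_le₀ (hpos i) (key i)
  refine ⟨?_, (hA.1.posSemidef_sub_smul_one_iff _).2 hbound, hbound⟩
  exact sub_pos.1 ((inv_pos.2 (hpos ⟨0, hp⟩)).trans_le (key ⟨0, hp⟩))
end

section
/- Let E be a real normed vector space, F ⊆ E a convex set, and φ : E → ℝ a function that is concave on F. Let e* ∈ F and let c > 0 and r₀ > 0 be such that φ(e*) ≥ φ(e) + c‖e − e*‖² for every e ∈ F with ‖e − e*‖ ≤ r₀. Then φ(e*) ≥ φ(e) + c · min(r₀, ‖e − e*‖) · ‖e − e*‖ for every e ∈ F. -/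
/-- A local quadratic gap at a maximizer-like point `e*` of a
concave function on a convex set upgrades to a global gap that grows linearly
outside the radius-`r₀` ball:
`φ(e*) ≥ φ(e) + c·min(r₀, ‖e − e*‖)·‖e − e*‖` for all `e ∈ F`. -/
theorem concave_local_quadratic_gap_global
    {E : Type*} [NormedAddCommGroup E] [NormedSpace ℝ E]
    (F : Set E) (hF : Convex ℝ F) (φ : E → ℝ) (hφ : ConcaveOn ℝ F φ)
    (estar : E) (hestar : estar ∈ F)
    (c r0 : ℝ) (hc : 0 < c) (hr0 : 0 < r0)
    (hloc : ∀ e ∈ F, ‖e - estar‖ ≤ r0 → φ e + c * ‖e - estar‖ ^ 2 ≤ φ estar) :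
    ∀ e ∈ F, φ e + c * min r0 ‖e - estar‖ * ‖e - estar‖ ≤ φ estar := by
  intro e he
  rcases le_total ‖e - estar‖ r0 with h | h
  · rw [min_eq_right h, mul_assoc, ← sq]
    exact hloc e he h
  rw [min_eq_left h]
  have hd : 0 < ‖e - estar‖ := hr0.trans_le h
  obtain ⟨t, ht⟩ : ∃ t, t = r0 / ‖e - estar‖ := ⟨_, rfl⟩
  have ht0 : 0 < t := ht ▸ div_pos hr0 hd
  have ht1 : 0 ≤ 1 - t := sub_nonneg.2 (ht ▸ (div_le_one hd).2 h)
  have htd : t * ‖e - estar‖ = r0 := by rw [ht, div_mul_cancel₀ _ hd.ne']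
  have hx : (1 - t) • estar + t • e ∈ F := hF hestar he ht1 ht0.le (by ring)
  have hnorm : ‖(1 - t) • estar + t • e - estar‖ = r0 := by
    rw [show (1 - t) • estar + t • e - estar = t • (e - estar) by module,
      norm_smul, Real.norm_of_nonneg ht0.le, htd]
  have hconc := hφ.2 hestar he ht1 ht0.le (by ring)
  have hgap := hloc _ hx hnorm.le
  rw [hnorm] at hgap
  simp only [smul_eq_mul] at hconc
  refine le_of_mul_le_mul_left ?_ ht0
  have hsq : t * (c * r0 * ‖e - estar‖) = c * r0 ^ 2 := by
    linear_combination c * r0 * htd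
  linarith
end
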